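/- Let n ≥ 1, Q = 2n+2, q = Q/(Q−2), q' = q/(q−1) = Q/2, M > 0 and κ > 2q/(q−1) = Q. Let Ψ : ℝ → [0,1] be C² with Ψ ≡ 1 on (−∞,0], Ψ ≡ 0 on [1,∞), |Ψ'| ≤ M and |Ψ''| ≤ M. For R > 1 define ψ₂(η) = Ψ(ln(|η|_ℍ/√R)/ln(√R))^κ. Then there is a constant C > 0, independent of R, such that for every R ≥ e, ∫_{ℝ^{2n+1}} ψ₂(η)^{−1/(q−1)} |Δ_ℍ ψ₂(η)|^{q'} dη ≤ C (ln R)^{1−Q/2}, where the integrand is taken to be 0 on the set where ψ₂ = 0. In particular this integral tends to 0 as R → ∞. -/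

import Mathlib

open MeasureTheory Real

noncomputable section

/-- The underlying space of the Heisenberg group `ℍⁿ ≅ ℝ^{2n+1}`,
written as triples `η = (x, y, τ)` with `x y : Fin n → ℝ`, `τ : ℝ`. -/
abbrev Heis (n : ℕ) : Type := (Fin n → ℝ) × (Fin n → ℝ) × ℝ

/-- Unit vector in the `x_i` direction. -/
def eX (n : ℕ) (i : Fin n) : Heis n := (Pi.single i 1, 0, 0)

/-- Unit vector in the `y_i` direction. -/
def eY (n : ℕ) (i : Fin n) : Heis n := (0, Pi.single i 1, 0)

/-- Unit vector in the `τ` direction. -/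
def eT (n : ℕ) : Heis n := (0, 0, 1)

/-- Partial derivative of `f` at `p` in direction `v`. -/
def pd (n : ℕ) (v : Heis n) (f : Heis n → ℝ) (p : Heis n) : ℝ := fderiv ℝ f p v

/-- The sub-Laplacian on the Heisenberg group, in coordinates:
`Δ_ℍ u = Δ_{(x,y)} u + 4(|x|²+|y|²) ∂²_{ττ} u + 4 Σᵢ (yᵢ ∂²_{xᵢτ} u − xᵢ ∂²_{yᵢτ} u)`. -/
def subLap (n : ℕ) (f : Heis n → ℝ) (p : Heis n) : ℝ :=
  (∑ i : Fin n, (pd n (eX n i) (pd n (eX n i) f) p + pd n (eY n i) (pd n (eY n i) f) p))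
    + 4 * (∑ i : Fin n, ((p.1 i) ^ 2 + (p.2.1 i) ^ 2)) * pd n (eT n) (pd n (eT n) f) p
    + 4 * ∑ i : Fin n, (p.2.1 i * pd n (eX n i) (pd n (eT n) f) p
        - p.1 i * pd n (eY n i) (pd n (eT n) f) p)

/-- The Korányi norm `|η|_ℍ = ((|x|²+|y|²)² + τ²)^{1/4}`. -/
def kor (n : ℕ) (p : Heis n) : ℝ :=
  ((∑ i : Fin n, ((p.1 i) ^ 2 + (p.2.1 i) ^ 2)) ^ 2 + p.2.2 ^ 2) ^ ((1 : ℝ) / 4)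


/-- The logarithmic cut-off `ψ₂(η) = Ψ(ln(|η|_ℍ/√R)/ln(√R))^κ`. -/
def psi2 (n : ℕ) (Ψ : ℝ → ℝ) (κ R : ℝ) (η : Heis n) : ℝ :=
  Ψ (Real.log (kor n η / Real.sqrt R) / Real.log (Real.sqrt R)) ^ κ

/-- The integrand `ψ₂^{-1/(q-1)} |Δ_ℍ ψ₂|^{q'}`, interpreted as `0` where `ψ₂ = 0`. -/
def critIntegrand (n : ℕ) (Ψ : ℝ → ℝ) (κ q q' R : ℝ) (η : Heis n) : ℝ :=
  if psi2 n Ψ κ R η = 0 then 0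
  else psi2 n Ψ κ R η ^ (-(1 : ℝ) / (q - 1)) * |subLap n (psi2 n Ψ κ R) η| ^ q'

/-- The squared Euclidean norm `|x|² + |y|²` of the horizontal part. -/
def horSq (n : ℕ) (p : Heis n) : ℝ := ∑ i : Fin n, ((p.1 i) ^ 2 + (p.2.1 i) ^ 2)

/-- The fourth power of the Korányi norm. -/
def korFour (n : ℕ) (p : Heis n) : ℝ := horSq n p ^ 2 + p.2.2 ^ 2

section SubLaplacian

variable {n : ℕ}

lemma horSq_nonneg (p : Heis n) : 0 ≤ horSq n p :=
  Finset.sum_nonneg fun _ _ => by positivity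

lemma korFour_nonneg (p : Heis n) : 0 ≤ korFour n p := by
  unfold korFour; positivity

lemma kor_eq (p : Heis n) : kor n p = korFour n p ^ ((1 : ℝ) / 4) := rfl

lemma kor_nonneg (p : Heis n) : 0 ≤ kor n p := rpow_nonneg (korFour_nonneg p) _

lemma kor_pow_four (p : Heis n) : kor n p ^ 4 = korFour n p := by
  rw [kor_eq, ← rpow_natCast, ← rpow_mul (korFour_nonneg p)]
  norm_num

lemma horSq_le_kor_sq (p : Heis n) : horSq n p ≤ kor n p ^ 2 := by
  refine le_of_sq_le_sq ?_ (by positivity)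
  rw [← pow_mul, kor_pow_four]
  unfold korFour
  nlinarith [sq_nonneg p.2.2]

lemma contDiff_horSq : ContDiff ℝ 2 (horSq n) := by
  unfold horSq; fun_prop

lemma contDiff_korFour : ContDiff ℝ 2 (korFour n) := by
  have := contDiff_horSq (n := n)
  unfold korFour; fun_prop

lemma continuous_kor : Continuous (kor n) :=
  contDiff_korFour.continuous.rpow_const fun _ => Or.inr (by norm_num)

/-- A directional derivative is the derivative along a line. -/
lemma pd_eq_of_hasDerivAt {f : Heis n → ℝ} {p v : Heis n} {d : ℝ} (hf : DifferentiableAt ℝ f p)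
    (h : HasDerivAt (fun t : ℝ => f (p + t • v)) d 0) : pd n v f p = d := by
  have hl : HasDerivAt (fun t : ℝ => p + t • v) v 0 := by
    simpa using ((hasDerivAt_id (0 : ℝ)).smul_const v).const_add p
  have hf' : HasFDerivAt f (fderiv ℝ f p) (p + (0 : ℝ) • v) := by
    simpa using hf.hasFDerivAt
  exact (hf'.comp_hasDerivAt (0 : ℝ) hl).unique h

lemma horSq_add_smul_eX (p : Heis n) (i : Fin n) (t : ℝ) :
    horSq n (p + t • eX n i) = horSq n p + 2 * p.1 i * t + t ^ 2 := by
  have h : ∀ j, ((p + t • eX n i).1 j) ^ 2 + ((p + t • eX n i).2.1 j) ^ 2 =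
      (p.1 j ^ 2 + p.2.1 j ^ 2) + if j = i then 2 * p.1 j * t + t ^ 2 else 0 := by
    intro j
    by_cases hj : j = i
    · subst hj; simp [eX]; ring
    · simp [eX, hj]
  simp only [horSq, h, Finset.sum_add_distrib]
  simp
  ring

lemma horSq_add_smul_eY (p : Heis n) (i : Fin n) (t : ℝ) :
    horSq n (p + t • eY n i) = horSq n p + 2 * p.2.1 i * t + t ^ 2 := by
  have h : ∀ j, ((p + t • eY n i).1 j) ^ 2 + ((p + t • eY n i).2.1 j) ^ 2 =
      (p.1 j ^ 2 + p.2.1 j ^ 2) + if j = i then 2 * p.2.1 j * t + t ^ 2 else 0 := by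
    intro j
    by_cases hj : j = i
    · subst hj; simp [eY]; ring
    · simp [eY, hj]
  simp only [horSq, h, Finset.sum_add_distrib]
  simp
  ring

lemma horSq_add_smul_eT (p : Heis n) (t : ℝ) : horSq n (p + t • eT n) = horSq n p := by
  simp [horSq, eT]

/-- A directional derivative of a function that is a quartic polynomial along the line is the
linear coefficient. -/
lemma pd_eq_of_quartic {f : Heis n → ℝ} {p v : Heis n} (hf : DifferentiableAt ℝ f p)
    (a b c d e : ℝ) (h : ∀ t : ℝ, f (p + t • v) = a + b * t + c * t ^ 2 + d * t ^ 3 + e * t ^ 4) :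
    pd n v f p = b := by
  refine pd_eq_of_hasDerivAt hf ?_
  simp only [h]
  have hid := hasDerivAt_id' (0 : ℝ)
  simpa using ((((hid.const_mul b).const_add a).fun_add ((hid.fun_pow 2).const_mul c)).fun_add
    ((hid.fun_pow 3).const_mul d)).fun_add ((hid.fun_pow 4).const_mul e)

lemma pd_eX_korFour (i : Fin n) :
    pd n (eX n i) (korFour n) = fun p => 4 * horSq n p * p.1 i := by
  funext p
  refine pd_eq_of_quartic (contDiff_korFour.differentiable (by norm_num) p) (korFour n p) _
    (4 * p.1 i ^ 2 + 2 * horSq n p) (4 * p.1 i) 1 fun t => ?_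
  simp only [korFour, horSq_add_smul_eX]
  simp [eX]
  ring

lemma pd_eY_korFour (i : Fin n) :
    pd n (eY n i) (korFour n) = fun p => 4 * horSq n p * p.2.1 i := by
  funext p
  refine pd_eq_of_quartic (contDiff_korFour.differentiable (by norm_num) p) (korFour n p) _
    (4 * p.2.1 i ^ 2 + 2 * horSq n p) (4 * p.2.1 i) 1 fun t => ?_
  simp only [korFour, horSq_add_smul_eY]
  simp [eY]
  ring

lemma pd_eT_korFour : pd n (eT n) (korFour n) = fun p => 2 * p.2.2 := by
  funext p
  refine pd_eq_of_quartic (contDiff_korFour.differentiable (by norm_num) p) (korFour n p) _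
    1 0 0 fun t => ?_
  simp only [korFour, horSq_add_smul_eT]
  simp [eT]
  ring

lemma differentiable_horSq : Differentiable ℝ (horSq n) :=
  contDiff_horSq.differentiable (by norm_num)

lemma pd_eX_eX_korFour (i : Fin n) (p : Heis n) :
    pd n (eX n i) (pd n (eX n i) (korFour n)) p = 4 * horSq n p + 8 * p.1 i ^ 2 := by
  rw [pd_eX_korFour]
  have := differentiable_horSq (n := n)
  refine pd_eq_of_quartic (by fun_prop) (4 * horSq n p * p.1 i) _ (12 * p.1 i) 4 0 fun t => ?_
  simp only [horSq_add_smul_eX]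
  simp [eX]
  ring

lemma pd_eY_eY_korFour (i : Fin n) (p : Heis n) :
    pd n (eY n i) (pd n (eY n i) (korFour n)) p = 4 * horSq n p + 8 * p.2.1 i ^ 2 := by
  rw [pd_eY_korFour]
  have := differentiable_horSq (n := n)
  refine pd_eq_of_quartic (by fun_prop) (4 * horSq n p * p.2.1 i) _ (12 * p.2.1 i) 4 0 fun t => ?_
  simp only [horSq_add_smul_eY]
  simp [eY]
  ring

lemma pd_eT_korFour_line (v p : Heis n) :
    pd n v (pd n (eT n) (korFour n)) p = 2 * v.2.2 := by
  rw [pd_eT_korFour]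
  refine pd_eq_of_quartic (by fun_prop) (2 * p.2.2) _ 0 0 0 fun t => ?_
  simp
  ring

lemma pd_congr {f g : Heis n → ℝ} {p : Heis n} (h : f =ᶠ[nhds p] g) (v : Heis n) :
    pd n v f =ᶠ[nhds p] pd n v g := by
  filter_upwards [h.fderiv (𝕜 := ℝ)] with x hx
  simp [pd, hx]

lemma subLap_congr {f g : Heis n → ℝ} {p : Heis n} (h : f =ᶠ[nhds p] g) :
    subLap n f p = subLap n g p := by
  have h2 : ∀ v w, pd n v (pd n w f) p = pd n v (pd n w g) p := fun v w =>
    (pd_congr (pd_congr h w) v).self_of_nhds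
  simp [subLap, h2]

lemma subLap_const (c : ℝ) (p : Heis n) : subLap n (fun _ => c) p = 0 := by
  have h : ∀ v, pd n v (fun _ : Heis n => c) = fun _ => 0 := fun v => by
    funext x; simp [pd]
  have h0 : ∀ v x, pd n v (fun _ : Heis n => (0 : ℝ)) x = 0 := fun v x => by simp [pd]
  simp [subLap, h, h0]

/-- Second-order chain rule for directional derivatives. -/
lemma pd_pd_comp {f : Heis n → ℝ} {G G₁ : ℝ → ℝ} {g₂ : ℝ} {p : Heis n} (v w : Heis n)
    (hf : ContDiff ℝ 2 f) (hG : ∀ᶠ s in nhds (f p), HasDerivAt G (G₁ s) s)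
    (hG₁ : HasDerivAt G₁ g₂ (f p)) :
    pd n v (pd n w (fun x => G (f x))) p =
      g₂ * (pd n v f p * pd n w f p) + G₁ (f p) * pd n v (pd n w f) p := by
  have hfd : Differentiable ℝ f := hf.differentiable (by norm_num)
  have hw : Differentiable ℝ (pd n w f) := by
    have : ContDiff ℝ 1 (fderiv ℝ f) := hf.fderiv_right (by norm_num)
    exact (this.clm_apply contDiff_const).differentiable (by norm_num)
  have h1 : pd n w (fun x => G (f x)) =ᶠ[nhds p] fun x => G₁ (f x) * pd n w f x := by
    filter_upwards [hfd.continuous.continuousAt.eventually hG] with x hx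
    have := (hx.comp_hasFDerivAt x (hfd x).hasFDerivAt).fderiv
    simp only [Function.comp_def] at this
    simp [pd, this]
  rw [(pd_congr h1 v).self_of_nhds]
  have h2 := (hG₁.comp_hasFDerivAt p (hfd p).hasFDerivAt).mul (hw p).hasFDerivAt
  have h3 := h2.fderiv
  simp only [Function.comp_def] at h3
  unfold pd at h3 ⊢
  erw [h3]
  simp
  ring

/-- The sub-Laplacian of a radial function. -/
lemma subLap_comp_korFour {G G₁ : ℝ → ℝ} {g₂ : ℝ} {p : Heis n}
    (hG : ∀ᶠ s in nhds (korFour n p), HasDerivAt G (G₁ s) s)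
    (hG₁ : HasDerivAt G₁ g₂ (korFour n p)) :
    subLap n (fun x => G (korFour n x)) p =
      horSq n p * (16 * korFour n p * g₂ + (8 * n + 16) * G₁ (korFour n p)) := by
  have hc : ∀ v w, pd n v (pd n w (fun x => G (korFour n x))) p = _ := fun v w =>
    pd_pd_comp v w contDiff_korFour hG hG₁
  simp only [subLap, hc, pd_eX_eX_korFour, pd_eY_eY_korFour, pd_eT_korFour_line]
  simp only [pd_eX_korFour, pd_eY_korFour, pd_eT_korFour]
  generalize G₁ (korFour n p) = g₁
  have hr : ∑ i : Fin n, ((p.1 i) ^ 2 + (p.2.1 i) ^ 2) = horSq n p := rfl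
  have hN : korFour n p = horSq n p ^ 2 + p.2.2 ^ 2 := rfl
  set r := horSq n p with hrdef
  have h1 : ∀ i : Fin n, (g₂ * (4 * r * p.1 i * (4 * r * p.1 i)) + g₁ * (4 * r + 8 * p.1 i ^ 2)
      + (g₂ * (4 * r * p.2.1 i * (4 * r * p.2.1 i)) + g₁ * (4 * r + 8 * p.2.1 i ^ 2)))
      = (16 * r ^ 2 * g₂ + 8 * g₁) * (p.1 i ^ 2 + p.2.1 i ^ 2) + 8 * g₁ * r := fun i => by ring
  have h2 : ∀ i : Fin n, (p.2.1 i * (g₂ * (4 * r * p.1 i * (2 * p.2.2)) + g₁ * (2 * (eX n i).2.2))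
      - p.1 i * (g₂ * (4 * r * p.2.1 i * (2 * p.2.2)) + g₁ * (2 * (eY n i).2.2))) = 0 := fun i => by
    simp [eX, eY]; ring
  simp only [h1, h2, Finset.sum_add_distrib, ← Finset.mul_sum, hr]
  simp [eT, hN]
  ring

end SubLaplacian

section RadialProfile

variable {Ψ : ℝ → ℝ} {κ L s : ℝ}

lemma hasDerivAt_log_div_sub (hs : s ≠ 0) :
    HasDerivAt (fun t => log t / (2 * L) - 1) (s⁻¹ / (2 * L)) s :=
  ((hasDerivAt_log hs).div_const _).sub_const _

lemma hasDerivAt_rpow_logCutoff (hΨ : ContDiff ℝ 2 Ψ) (hs : s ≠ 0)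
    (hpos : 0 < Ψ (log s / (2 * L) - 1)) :
    HasDerivAt (fun t => Ψ (log t / (2 * L) - 1) ^ κ)
      (κ * Ψ (log s / (2 * L) - 1) ^ (κ - 1) * deriv Ψ (log s / (2 * L) - 1) *
        (s⁻¹ / (2 * L))) s := by
  have h : HasDerivAt (fun t => Ψ (log t / (2 * L) - 1))
      (deriv Ψ (log s / (2 * L) - 1) * (s⁻¹ / (2 * L))) s :=
    (hΨ.differentiable (by norm_num) _).hasDerivAt.comp s (hasDerivAt_log_div_sub hs)
  convert h.rpow_const (p := κ) (Or.inl hpos.ne') using 1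
  ring

lemma hasDerivAt_deriv_rpow_logCutoff (hΨ : ContDiff ℝ 2 Ψ) (hs : s ≠ 0)
    (hpos : 0 < Ψ (log s / (2 * L) - 1)) :
    HasDerivAt (fun t => κ * Ψ (log t / (2 * L) - 1) ^ (κ - 1) *
        deriv Ψ (log t / (2 * L) - 1) * (t⁻¹ / (2 * L)))
      ((κ * (κ - 1) * Ψ (log s / (2 * L) - 1) ^ (κ - 2) * deriv Ψ (log s / (2 * L) - 1) ^ 2 +
          κ * Ψ (log s / (2 * L) - 1) ^ (κ - 1) * deriv (deriv Ψ) (log s / (2 * L) - 1)) *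
            (s⁻¹ / (2 * L)) ^ 2 -
        κ * Ψ (log s / (2 * L) - 1) ^ (κ - 1) * deriv Ψ (log s / (2 * L) - 1) *
          (s⁻¹ ^ 2 / (2 * L))) s := by
  have hz := hasDerivAt_log_div_sub (L := L) hs
  have h1 := (hasDerivAt_rpow_logCutoff (κ := κ - 1) hΨ hs hpos).const_mul κ
  have h2 : HasDerivAt (fun t => deriv Ψ (log t / (2 * L) - 1))
      (deriv (deriv Ψ) (log s / (2 * L) - 1) * (s⁻¹ / (2 * L))) s :=
    (hΨ.differentiable_deriv_two _).hasDerivAt.comp s hz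
  have h3 := (hasDerivAt_inv hs).div_const (2 * L)
  refine ((h1.fun_mul h2).fun_mul h3).congr_deriv ?_
  rw [show κ - 1 - 1 = κ - 2 by ring]
  field_simp
  ring

end RadialProfile

section CutoffBound

variable {n : ℕ} {Ψ : ℝ → ℝ} {κ M R : ℝ}

lemma log_kor_div_sqrt {p : Heis n} (hp : 0 < korFour n p) (hR : 1 ≤ log R) (hR0 : 0 < R) :
    log (kor n p / √R) / log √R = log (korFour n p) / (2 * log R) - 1 := by
  rw [log_div (by rw [kor_eq]; positivity) (by positivity), kor_eq, log_rpow hp,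
    log_sqrt hR0.le]
  field_simp
  ring

/-- The constant in the pointwise bound for the sub-Laplacian of the cut-off. -/
def cutoffConst (n : ℕ) (κ M : ℝ) : ℝ :=
  κ * (4 * (κ * M ^ 2 + M) + 4 * n * M)

lemma abs_subLap_psi2_le (hΨ : ContDiff ℝ 2 Ψ) (hΨrange : ∀ z, Ψ z ∈ Set.Icc (0 : ℝ) 1)
    (hΨ' : ∀ z, |deriv Ψ z| ≤ M) (hΨ'' : ∀ z, |deriv (deriv Ψ) z| ≤ M)
    (hκ : 1 ≤ κ) (hR0 : 0 < R) (hR : 1 ≤ log R) {p : Heis n} (hp : 0 < kor n p)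
    (hpos : 0 < Ψ (log (kor n p / √R) / log √R)) :
    |subLap n (psi2 n Ψ κ R) p| ≤
      cutoffConst n κ M * Ψ (log (kor n p / √R) / log √R) ^ (κ - 2) /
        (log R * kor n p ^ 2) := by
  have hN : 0 < korFour n p := by rw [← kor_pow_four]; positivity
  have hLpos : 0 < log R := by linarith
  rw [log_kor_div_sqrt hN hR hR0] at hpos ⊢
  have hcongr : psi2 n Ψ κ R =ᶠ[nhds p]
      fun x => Ψ (log (korFour n x) / (2 * log R) - 1) ^ κ := by
    filter_upwards [contDiff_korFour.continuous.continuousAt.eventually (lt_mem_nhds hN)]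
      with x hx
    rw [psi2, log_kor_div_sqrt hx hR hR0]
  have hev : ∀ᶠ s in nhds (korFour n p), HasDerivAt (fun t => Ψ (log t / (2 * log R) - 1) ^ κ)
      (κ * Ψ (log s / (2 * log R) - 1) ^ (κ - 1) * deriv Ψ (log s / (2 * log R) - 1) *
        (s⁻¹ / (2 * log R))) s := by
    have hcont : ContinuousAt (fun t => Ψ (log t / (2 * log R) - 1)) (korFour n p) :=
      hΨ.continuous.continuousAt.comp (hasDerivAt_log_div_sub hN.ne').continuousAt
    filter_upwards [lt_mem_nhds hN, hcont.eventually (lt_mem_nhds hpos)] with s hs hs'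
    exact hasDerivAt_rpow_logCutoff hΨ hs.ne' hs'
  rw [subLap_congr hcongr,
    subLap_comp_korFour (G := fun t => Ψ (log t / (2 * log R) - 1) ^ κ) hev
      (hasDerivAt_deriv_rpow_logCutoff hΨ hN.ne' hpos)]
  have hr := horSq_le_kor_sq p
  have hr0 := horSq_nonneg p
  have hN4 := kor_pow_four p
  generalize log (korFour n p) / (2 * log R) - 1 = z at hpos ⊢
  have ha1 : Ψ z ^ (κ - 1) ≤ Ψ z ^ (κ - 2) :=
    rpow_le_rpow_of_exponent_ge hpos (hΨrange z).2 (by linarith)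
  have hb0 : 0 < Ψ z ^ (κ - 1) := rpow_pos_of_pos hpos _
  have ha0 : 0 < Ψ z ^ (κ - 2) := rpow_pos_of_pos hpos _
  have hd1 := hΨ' z
  have hd2 := hΨ'' z
  generalize Ψ z ^ (κ - 1) = b at *
  generalize Ψ z ^ (κ - 2) = a at *
  generalize deriv (deriv Ψ) z = d₂ at *
  generalize deriv Ψ z = d₁ at *
  generalize horSq n p = r at *
  generalize korFour n p = N at *
  generalize log R = L at *
  generalize kor n p = ρ at *
  have hbd1 : |b * d₁| ≤ a * M := by
    rw [abs_mul, abs_of_pos hb0]; gcongr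
  have hbd2 : |b * d₂| ≤ a * M := by
    rw [abs_mul, abs_of_pos hb0]; gcongr
  have had : |(κ - 1) * a * d₁ ^ 2| ≤ κ * a * M ^ 2 := by
    rw [abs_mul, abs_mul, abs_of_pos ha0, abs_of_nonneg (by linarith : 0 ≤ κ - 1), abs_pow]
    gcongr
    linarith
  have hκ0 : 0 < κ := by linarith
  have hform : r * (16 * N * ((κ * (κ - 1) * a * d₁ ^ 2 + κ * b * d₂) * (N⁻¹ / (2 * L)) ^ 2 -
      κ * b * d₁ * (N⁻¹ ^ 2 / (2 * L))) + (8 * n + 16) * (κ * b * d₁ * (N⁻¹ / (2 * L)))) =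
      r / (L * N) * κ * (4 / L * ((κ - 1) * a * d₁ ^ 2 + b * d₂) +
        4 * n * (b * d₁)) := by
    field_simp
    ring
  rw [hform, abs_mul, abs_of_nonneg (by positivity : 0 ≤ r / (L * N) * κ)]
  have hL4 : 4 / L ≤ 4 := by rw [div_le_iff₀ hLpos]; linarith
  have hinner : |4 / L * ((κ - 1) * a * d₁ ^ 2 + b * d₂) +
        4 * n * (b * d₁)| ≤
      4 * (κ * a * M ^ 2 + a * M) + 4 * n * (a * M) := by
    refine (abs_add_le _ _).trans ?_
    rw [abs_mul, abs_mul, abs_of_pos (by positivity : 0 < 4 / L),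
      abs_of_nonneg (by positivity : (0 : ℝ) ≤ 4 * n)]
    gcongr
    exact (abs_add_le _ _).trans (add_le_add had hbd2)
  have hrN : r / (L * N) ≤ 1 / (L * ρ ^ 2) := by
    rw [div_le_div_iff₀ (by positivity) (by positivity), ← hN4]
    nlinarith [mul_le_mul_of_nonneg_left hr (by positivity : 0 ≤ L * ρ ^ 2)]
  calc r / (L * N) * κ * _ ≤ 1 / (L * ρ ^ 2) * κ *
        (4 * (κ * a * M ^ 2 + a * M) + 4 * n * (a * M)) := by gcongr
    _ = _ := by unfold cutoffConst; ring

lemma subLap_psi2_eq_zero (hΨone : ∀ z : ℝ, z ≤ 0 → Ψ z = 1) (hR : 1 < R) {p : Heis n}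
    (hp : kor n p < √R) : subLap n (psi2 n Ψ κ R) p = 0 := by
  have hcongr : psi2 n Ψ κ R =ᶠ[nhds p] fun _ => 1 := by
    filter_upwards [continuous_kor.continuousAt.eventually (gt_mem_nhds hp)] with x hx
    have hsq : 1 < √R := by rwa [lt_sqrt zero_le_one, one_pow]
    rw [psi2, hΨone, one_rpow]
    exact div_nonpos_of_nonpos_of_nonneg
      (log_nonpos (div_nonneg (kor_nonneg x) (sqrt_nonneg R))
        ((div_le_one (by positivity)).2 hx.le)) (log_nonneg hsq.le)
  rw [subLap_congr hcongr, subLap_const]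

lemma psi2_eq_zero (hΨzero : ∀ z : ℝ, 1 ≤ z → Ψ z = 0) (hκ : κ ≠ 0) (hR : 1 < R) {p : Heis n}
    (hp : R < kor n p) : psi2 n Ψ κ R p = 0 := by
  have hsq : 1 < √R := by rwa [lt_sqrt zero_le_one, one_pow]
  rw [psi2, hΨzero, zero_rpow hκ]
  rw [one_le_div (log_pos hsq)]
  refine log_le_log (by positivity) ?_
  rw [le_div_iff₀ (by positivity), mul_self_sqrt (by linarith)]
  exact hp.le

lemma critIntegrand_nonneg (hΨrange : ∀ z, Ψ z ∈ Set.Icc (0 : ℝ) 1) (q q' : ℝ) (p : Heis n) :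
    0 ≤ critIntegrand n Ψ κ q q' R p := by
  unfold critIntegrand psi2
  split_ifs
  · exact le_rfl
  · have := (hΨrange (log (kor n p / √R) / log √R)).1
    positivity

/-- The weights cancel: `a` is the value of the cut-off, `ρ` the Korányi norm. -/
lemma rpow_mul_div_rpow_le {a K L ρ q' : ℝ} {Q : ℕ} (ha : 0 < a) (ha1 : a ≤ 1) (hK : 0 ≤ K)
    (hL : 0 < L) (hρ : 0 < ρ) (hq' : q' = (Q : ℝ) / 2) (hκ : (Q : ℝ) ≤ κ) :
    (a ^ κ) ^ (1 - q') * (K * a ^ (κ - 2) / (L * ρ ^ 2)) ^ q' ≤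
      K ^ q' * L ^ (-q') * (ρ ^ Q)⁻¹ := by
  have hρQ : (ρ ^ 2) ^ q' = ρ ^ Q := by
    rw [← rpow_natCast ρ 2, ← rpow_natCast ρ Q, ← rpow_mul hρ.le, hq']
    congr 1
    push_cast
    ring
  have h1 : (a ^ κ) ^ (1 - q') * (a ^ (κ - 2)) ^ q' ≤ 1 := by
    rw [← rpow_mul ha.le, ← rpow_mul ha.le, ← rpow_add ha]
    refine rpow_le_one ha.le ha1 ?_
    rw [hq']
    linarith
  rw [div_rpow (by positivity) (by positivity), mul_rpow hK (by positivity),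
    mul_rpow hL.le (by positivity), hρQ, rpow_neg hL.le]
  calc _ = ((a ^ κ) ^ (1 - q') * (a ^ (κ - 2)) ^ q') *
        (K ^ q' * (L ^ q')⁻¹ * (ρ ^ Q)⁻¹) := by field_simp
    _ ≤ 1 * (K ^ q' * (L ^ q')⁻¹ * (ρ ^ Q)⁻¹) := by gcongr
    _ = _ := one_mul _

lemma critIntegrand_le {Q : ℕ} {q q' : ℝ} (hΨ : ContDiff ℝ 2 Ψ)
    (hΨrange : ∀ z, Ψ z ∈ Set.Icc (0 : ℝ) 1)
    (hΨ' : ∀ z, |deriv Ψ z| ≤ M) (hΨ'' : ∀ z, |deriv (deriv Ψ) z| ≤ M) (hM : 0 < M)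
    (hκ1 : 1 ≤ κ) (hR0 : 0 < R) (hR : 1 ≤ log R) (hq' : q' = (Q : ℝ) / 2)
    (hq : -(1 : ℝ) / (q - 1) = 1 - q') (hκ : (Q : ℝ) ≤ κ) {p : Heis n} (hp : 0 < kor n p) :
    critIntegrand n Ψ κ q q' R p ≤
      cutoffConst n κ M ^ q' * log R ^ (-q') * (kor n p ^ Q)⁻¹ := by
  have hK : 0 ≤ cutoffConst n κ M := by unfold cutoffConst; positivity
  unfold critIntegrand
  split_ifs with h
  · positivity
  · have hz := hΨrange (log (kor n p / √R) / log √R)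
    have hpos : 0 < Ψ (log (kor n p / √R) / log √R) := by
      refine lt_of_le_of_ne hz.1 fun h0 => h ?_
      rw [psi2, ← h0, zero_rpow (by linarith)]
    rw [hq]
    refine le_trans ?_ (rpow_mul_div_rpow_le hpos hz.2 hK (by linarith) hp hq' hκ)
    unfold psi2
    gcongr
    · rw [hq']; positivity
    · exact abs_subLap_psi2_le hΨ hΨrange hΨ' hΨ'' hκ1 hR0 hR hp hpos

end CutoffBound

section Dyadic

variable {n : ℕ}

/-- The anisotropic box containing the Korányi ball of radius `s`. -/
def korBox (n : ℕ) (s : ℝ) : Set (Heis n) :=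
  Set.Icc (fun _ => -s) (fun _ => s) ×ˢ Set.Icc (fun _ => -s) (fun _ => s) ×ˢ
    Set.Icc (-s ^ 2) (s ^ 2)

lemma measurableSet_korBox (s : ℝ) : MeasurableSet (korBox n s) :=
  measurableSet_Icc.prod (measurableSet_Icc.prod measurableSet_Icc)

lemma isCompact_korBox (s : ℝ) : IsCompact (korBox n s) :=
  isCompact_Icc.prod (isCompact_Icc.prod isCompact_Icc)

lemma volume_real_korBox {s : ℝ} (hs : 0 ≤ s) :
    (volume : Measure (Heis n)).real (korBox n s) = 2 ^ (2 * n + 1) * s ^ (2 * n + 2) := by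
  have h : (volume : Measure (Fin n → ℝ)).real (Set.Icc (fun _ => -s) (fun _ => s)) =
      (2 * s) ^ n := by
    rw [Measure.real, Real.volume_Icc_pi_toReal (fun _ => by linarith)]
    simp [two_mul]
  rw [korBox, Measure.volume_eq_prod, measureReal_prod_prod, Measure.volume_eq_prod,
    measureReal_prod_prod, h, Real.volume_real_Icc_of_le (by nlinarith)]
  ring

lemma mem_korBox {s : ℝ} {p : Heis n} (hp : kor n p ≤ s) : p ∈ korBox n s := by
  have hs : 0 ≤ s := (kor_nonneg p).trans hp
  have hr : horSq n p ≤ s ^ 2 :=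
    (horSq_le_kor_sq p).trans (pow_le_pow_left₀ (kor_nonneg p) hp 2)
  have hi : ∀ i, p.1 i ^ 2 + p.2.1 i ^ 2 ≤ s ^ 2 := fun i =>
    (Finset.single_le_sum (f := fun i => p.1 i ^ 2 + p.2.1 i ^ 2)
      (fun _ _ => by positivity) (Finset.mem_univ i)).trans hr
  have hx : ∀ i, |p.1 i| ≤ s := fun i =>
    abs_le_of_sq_le_sq (by nlinarith [hi i, sq_nonneg (p.2.1 i)]) hs
  have hy : ∀ i, |p.2.1 i| ≤ s := fun i =>
    abs_le_of_sq_le_sq (by nlinarith [hi i, sq_nonneg (p.1 i)]) hs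
  have ht : |p.2.2| ≤ s ^ 2 := by
    refine abs_le_of_sq_le_sq ?_ (by positivity)
    calc p.2.2 ^ 2 ≤ korFour n p := by unfold korFour; nlinarith [sq_nonneg (horSq n p)]
      _ = kor n p ^ 4 := (kor_pow_four p).symm
      _ ≤ s ^ 4 := pow_le_pow_left₀ (kor_nonneg p) hp 4
      _ = (s ^ 2) ^ 2 := by ring
  exact ⟨⟨fun i => (abs_le.1 (hx i)).1, fun i => (abs_le.1 (hx i)).2⟩,
    ⟨fun i => (abs_le.1 (hy i)).1, fun i => (abs_le.1 (hy i)).2⟩, abs_le.1 ht⟩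

/-- A step function dominating `|η|_ℍ^{-Q}` on the annulus `1 ≤ |η|_ℍ ≤ R`. -/
def annulusStep (n Q : ℕ) (R : ℝ) (p : Heis n) : ℝ :=
  ∑ k ∈ Finset.range (⌊log R⌋₊ + 1),
    (korBox n (exp (k + 1))).indicator (fun _ => (exp k ^ Q)⁻¹) p

lemma annulusStep_nonneg (Q : ℕ) (R : ℝ) (p : Heis n) : 0 ≤ annulusStep n Q R p :=
  Finset.sum_nonneg fun _ _ => Set.indicator_nonneg (fun _ _ => by positivity) _

lemma inv_kor_pow_le_annulusStep (Q : ℕ) {R : ℝ} {p : Heis n} (h1 : 1 ≤ kor n p)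
    (hR : kor n p ≤ R) : (kor n p ^ Q)⁻¹ ≤ annulusStep n Q R p := by
  have hρ : 0 < kor n p := by linarith
  have hlog : 0 ≤ log (kor n p) := log_nonneg h1
  have hk : ⌊log (kor n p)⌋₊ ∈ Finset.range (⌊log R⌋₊ + 1) :=
    Finset.mem_range.2 (Nat.lt_succ_of_le (Nat.floor_mono (log_le_log hρ hR)))
  refine le_trans ?_ (Finset.single_le_sum
    (fun k _ => Set.indicator_nonneg (fun _ _ => by positivity) p) hk)
  rw [Set.indicator_of_mem (mem_korBox ((log_le_iff_le_exp hρ).1 (Nat.lt_floor_add_one _).le))]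
  gcongr
  exact (le_log_iff_exp_le hρ).1 (Nat.floor_le hlog)

lemma integrable_indicator_korBox (s c : ℝ) :
    Integrable ((korBox n s).indicator fun _ => c) :=
  (integrable_indicator_iff (measurableSet_korBox s)).2
    (integrableOn_const (isCompact_korBox s).measure_lt_top.ne)

lemma integrable_annulusStep (Q : ℕ) (R : ℝ) : Integrable (annulusStep n Q R) :=
  integrable_finsetSum _ fun _ _ => integrable_indicator_korBox _ _

lemma integral_annulusStep (R : ℝ) :
    ∫ p, annulusStep n (2 * n + 2) R p =
      (⌊log R⌋₊ + 1) * (2 ^ (2 * n + 1) * exp 1 ^ (2 * n + 2)) := by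
  unfold annulusStep
  rw [integral_finsetSum _ fun _ _ => integrable_indicator_korBox _ _]
  have h : ∀ k : ℕ, ∫ p : Heis n, (korBox n (exp (k + 1))).indicator
      (fun _ => (exp k ^ (2 * n + 2))⁻¹) p = 2 ^ (2 * n + 1) * exp 1 ^ (2 * n + 2) := by
    intro k
    rw [integral_indicator (measurableSet_korBox _), setIntegral_const,
      volume_real_korBox (exp_pos _).le, smul_eq_mul, exp_add, mul_pow]
    field_simp
  simp [h]

end Dyadic

/-- **Spatial part of the critical-case estimates `J₁`–`J₃` of Lemma 2.3:** for
`q = Q/(Q-2)`, `q' = q/(q-1) = Q/2` and `κ > 2q/(q-1) = Q`,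
`∫_{ℍⁿ} ψ₂^{-1/(q-1)} |Δ_ℍ ψ₂|^{q'} dη ≤ C (ln R)^{1-Q/2}` with `C` independent of
`R ≥ e`; in particular the integral tends to `0` as `R → ∞`. -/
theorem critical_spatial_integral_estimate (n Q : ℕ) (hn : 1 ≤ n) (hQ : Q = 2 * n + 2)
    (q q' M κ : ℝ) (hq : q = (Q : ℝ) / ((Q : ℝ) - 2)) (hq' : q' = q / (q - 1))
    (hM : 0 < M) (hκ : 2 * q / (q - 1) < κ)
    (Ψ : ℝ → ℝ) (hΨ : ContDiff ℝ 2 Ψ)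
    (hΨrange : ∀ z : ℝ, Ψ z ∈ Set.Icc (0 : ℝ) 1)
    (hΨone : ∀ z : ℝ, z ≤ 0 → Ψ z = 1)
    (hΨzero : ∀ z : ℝ, 1 ≤ z → Ψ z = 0)
    (hΨ' : ∀ z : ℝ, |deriv Ψ z| ≤ M)
    (hΨ'' : ∀ z : ℝ, |deriv (deriv Ψ) z| ≤ M) :
    (∃ C : ℝ, 0 < C ∧ ∀ R : ℝ, Real.exp 1 ≤ R →
        (∫ η : Heis n, critIntegrand n Ψ κ q q' R η)
          ≤ C * Real.log R ^ (1 - (Q : ℝ) / 2)) ∧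
      Filter.Tendsto (fun R : ℝ => ∫ η : Heis n, critIntegrand n Ψ κ q q' R η)
        Filter.atTop (nhds 0) := by
  have hn' : (1 : ℝ) ≤ n := by exact_mod_cast hn
  have hQ' : (Q : ℝ) = 2 * n + 2 := by rw [hQ]; push_cast; ring
  have hq1 : q - 1 = 1 / n := by
    rw [hq, hQ', add_sub_cancel_right]; field_simp; ring
  have hqQ : q' = (Q : ℝ) / 2 := by
    rw [hq', hq1, hq, hQ', add_sub_cancel_right]; field_simp
  have hκQ : (Q : ℝ) < κ := by
    have : 2 * q / (q - 1) = Q := by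
      rw [mul_div_assoc, ← hq', hqQ]; ring
    rwa [this] at hκ
  have hexp : -(1 : ℝ) / (q - 1) = 1 - q' := by
    rw [hqQ, hq1, hQ']; field_simp; ring
  have hκ1 : 1 ≤ κ := by linarith
  set A := cutoffConst n κ M ^ q'
  have hK : 0 < cutoffConst n κ M := by unfold cutoffConst; positivity
  have hA0 : 0 < A := rpow_pos_of_pos hK _
  have hbound : ∀ R : ℝ, exp 1 ≤ R → ∫ η : Heis n, critIntegrand n Ψ κ q q' R η ≤
      2 * A * (2 ^ (2 * n + 1) * exp 1 ^ (2 * n + 2)) * log R ^ (1 - (Q : ℝ) / 2) := by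
    intro R hR
    have hR0 : 0 < R := (exp_pos 1).trans_le hR
    have hL : 1 ≤ log R := (le_log_iff_exp_le hR0).2 hR
    have hR1 : 1 < R := (one_lt_exp_iff.2 one_pos).trans_le hR
    have hL0 : 0 < log R := by linarith
    have hpt : ∀ p : Heis n, critIntegrand n Ψ κ q q' R p ≤
        A * log R ^ (-q') * annulusStep n (2 * n + 2) R p := by
      intro p
      have hnn : 0 ≤ A * log R ^ (-q') * annulusStep n (2 * n + 2) R p :=
        mul_nonneg (by positivity) (annulusStep_nonneg _ _ _)
      rcases lt_or_ge (kor n p) √R with h | h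
      · refine le_trans (le_of_eq ?_) hnn
        rw [critIntegrand, subLap_psi2_eq_zero hΨone hR1 h, abs_zero,
          zero_rpow (by rw [hqQ, hQ']; positivity), mul_zero, ite_self]
      rcases lt_or_ge R (kor n p) with h' | h'
      · refine le_trans (le_of_eq ?_) hnn
        rw [critIntegrand, if_pos (psi2_eq_zero hΨzero (by linarith) hR1 h')]
      have h1 : 1 ≤ kor n p := (one_le_sqrt.2 hR1.le).trans h
      refine (critIntegrand_le hΨ hΨrange hΨ' hΨ'' hM hκ1 hR0 hL hqQ hexp hκQ.le
        (by linarith)).trans ?_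
      rw [hQ]
      gcongr
      exact inv_kor_pow_le_annulusStep _ h1 h'
    calc ∫ η : Heis n, critIntegrand n Ψ κ q q' R η
        ≤ ∫ p, A * log R ^ (-q') * annulusStep n (2 * n + 2) R p :=
          integral_mono_of_nonneg (.of_forall fun p => critIntegrand_nonneg hΨrange q q' p)
            ((integrable_annulusStep _ R).const_mul _) (.of_forall hpt)
      _ = A * log R ^ (-q') *
          ((⌊log R⌋₊ + 1) * (2 ^ (2 * n + 1) * exp 1 ^ (2 * n + 2))) := by
          rw [integral_const_mul, integral_annulusStep]
      _ ≤ A * log R ^ (-q') *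
          ((2 * log R) * (2 ^ (2 * n + 1) * exp 1 ^ (2 * n + 2))) := by
          gcongr
          linarith [Nat.floor_le hL0.le]
      _ = _ := by
          rw [sub_eq_neg_add, rpow_add hL0, rpow_one, hqQ]
          ring
  refine ⟨⟨_, by positivity, hbound⟩, ?_⟩
  have hlim : Filter.Tendsto (fun R : ℝ => 2 * A * (2 ^ (2 * n + 1) * exp 1 ^ (2 * n + 2)) *
      log R ^ (1 - (Q : ℝ) / 2)) Filter.atTop (nhds 0) := by
    have h := ((tendsto_rpow_neg_atTop (y := (Q : ℝ) / 2 - 1)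
      (by rw [hQ']; linarith)).comp tendsto_log_atTop).const_mul
        (2 * A * (2 ^ (2 * n + 1) * exp 1 ^ (2 * n + 2)))
    simpa [Function.comp_def] using h
  exact tendsto_of_tendsto_of_tendsto_of_le_of_le' tendsto_const_nhds hlim
    (.of_forall fun R => integral_nonneg fun p => critIntegrand_nonneg hΨrange q q' p)
    ((Filter.eventually_ge_atTop (exp 1)).mono hbound)
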